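/- Let u : [0,1]² → ℝ be a continuous probability density. Then max_{Υ ∈ B↗([0,1]²)} J̃(u,Υ) = lim_{N→∞} lim_{m→∞} max_{Γ ∈ Π_{N,m}} 2 Σ_{k=1}^{2N−1} (∫_{x_{k−1}}^{x_k} ∫_{y_{k−1}}^{y_k} u(x,y) dx dy)^{1/2}, where for each refined path Γ the points (x_k,y_k) are the centers of its crossing intervals, with (x_0,y_0) = (0,0) and (x_{2N−1},y_{2N−1}) = (1,1). -/

import Mathlib

open Filter MeasureTheory

/-- A monotone partition of the box `[a1,a2]×[b1,b2]` all of whose points lie on `Υ`. -/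
def IsPartitionOn (a1 a2 b1 b2 : ℝ) (Υ : Set (ℝ × ℝ)) (n : ℕ) (x y : Fin (n + 1) → ℝ) : Prop :=
  Monotone x ∧ Monotone y ∧ x 0 = a1 ∧ y 0 = b1 ∧ x (Fin.last n) = a2 ∧ y (Fin.last n) = b2 ∧
    ∀ k : Fin (n + 1), (x k, y k) ∈ Υ

/-- `J̃(u,P) = 2 Σ_k (∫_{x_k}^{x_{k+1}} ∫_{y_k}^{y_{k+1}} u(x,y) dx dy)^{1/2}`. -/
noncomputable def Jpart (u : ℝ × ℝ → ℝ) (n : ℕ) (x y : Fin (n + 1) → ℝ) : ℝ :=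
  2 * ∑ k : Fin n,
    Real.sqrt (∫ s in (x k.castSucc)..(x k.succ), ∫ t in (y k.castSucc)..(y k.succ), u (s, t))

/-- `J̃(u,Υ) = lim_{ε→0} inf {J̃(u,P) : P a partition with points on Υ, mesh < ε}`. -/
noncomputable def Jcurve (a1 a2 b1 b2 : ℝ) (u : ℝ × ℝ → ℝ) (Υ : Set (ℝ × ℝ)) : ℝ :=
  ⨆ ε : {e : ℝ // 0 < e},
    sInf {r : ℝ | ∃ (n : ℕ) (x y : Fin (n + 1) → ℝ),
      IsPartitionOn a1 a2 b1 b2 Υ n x y ∧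
      (∀ k : Fin n, x k.succ - x k.castSucc < (ε : ℝ) ∧ y k.succ - y k.castSucc < (ε : ℝ)) ∧
      r = Jpart u n x y}

/-- `B↗`: connected monotone subsets of the box containing both corners. -/
def Bup (a1 a2 b1 b2 : ℝ) : Set (Set (ℝ × ℝ)) :=
  {Υ | Υ ⊆ Set.Icc (a1, b1) (a2, b2) ∧ IsConnected Υ ∧ (a1, b1) ∈ Υ ∧ (a2, b2) ∈ Υ ∧
    ∀ p ∈ Υ, ∀ q ∈ Υ, 0 ≤ (p.1 - q.1) * (p.2 - q.2)}

/-- A refined path of boxes `Γ ∈ Π_{N,m}`. -/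
structure RefinedPath (N m : ℕ) where
  i : ℕ → ℕ
  j : ℕ → ℕ
  r : ℕ → ℕ
  start_i : i 1 = 1
  start_j : j 1 = 1
  stop_i : i (2 * N - 1) = N
  stop_j : j (2 * N - 1) = N
  step : ∀ k, 1 ≤ k → k ≤ 2 * N - 2 →
    (i (k + 1) = i k + 1 ∧ j (k + 1) = j k) ∨ (i (k + 1) = i k ∧ j (k + 1) = j k + 1)
  r_mem : ∀ k, 1 ≤ k → k ≤ 2 * N - 2 → 1 ≤ r k ∧ r k ≤ m
  r_mono : ∀ k, 1 ≤ k → k ≤ 2 * N - 3 →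
    ((i k = i (k + 1) ∧ i (k + 1) = i (k + 2)) ∨ (j k = j (k + 1) ∧ j (k + 1) = j (k + 2))) →
    r k ≤ r (k + 1)

/-- Center of the `k`-th crossing interval of a refined path. -/
noncomputable def RefinedPath.center {N m : ℕ} (Γ : RefinedPath N m) (k : ℕ) : ℝ × ℝ :=
  if Γ.i (k + 1) = Γ.i k + 1 then
    ((Γ.i k : ℝ) / N, ((Γ.j k : ℝ) - 1) / N + ((Γ.r k : ℝ) - 1 / 2) / (m * N))
  else
    (((Γ.i k : ℝ) - 1) / N + ((Γ.r k : ℝ) - 1 / 2) / (m * N), (Γ.j k : ℝ) / N)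

/-- The centers, extended by the corners `(0,0)` at `k = 0` and `(1,1)` at `k = 2N-1`. -/
noncomputable def RefinedPath.pt {N m : ℕ} (Γ : RefinedPath N m) (k : ℕ) : ℝ × ℝ :=
  if k = 0 then (0, 0) else if k = 2 * N - 1 then (1, 1) else Γ.center k

/-- The sum `2 Σ_{k=1}^{2N-1} (∫_{x_{k-1}}^{x_k} ∫_{y_{k-1}}^{y_k} u)^{1/2}` along a
refined path, where `(x_k,y_k)` are the crossing-interval centers. -/
noncomputable def pathSum (u : ℝ × ℝ → ℝ) (N m : ℕ) (Γ : RefinedPath N m) : ℝ :=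
  2 * ∑ k ∈ Finset.Icc 1 (2 * N - 1),
    Real.sqrt (∫ s in ((Γ.pt (k - 1)).1)..((Γ.pt k).1),
      ∫ t in ((Γ.pt (k - 1)).2)..((Γ.pt k).2), u (s, t))

open Set intervalIntegral

/-- integral over a box -/
noncomputable def bx (u : ℝ × ℝ → ℝ) (p q : ℝ × ℝ) : ℝ :=
  ∫ s in p.1..q.1, ∫ t in p.2..q.2, u (s, t)

/-- chain sum -/
noncomputable def cs (u : ℝ × ℝ → ℝ) (n : ℕ) (P : ℕ → ℝ × ℝ) : ℝ :=
  2 * ∑ k ∈ Finset.range n, Real.sqrt (bx u (P k) (P (k + 1)))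

lemma inner_cont {u : ℝ × ℝ → ℝ} (hu : Continuous u) (c d : ℝ) :
    Continuous (fun s => ∫ t in c..d, u (s, t)) := by
  apply intervalIntegral.continuous_parametric_intervalIntegral_of_continuous' (f := fun s t => u (s, t))
  exact hu

lemma bx_le {u : ℝ × ℝ → ℝ} (hu : Continuous u) {p q : ℝ × ℝ} (hpq : p ≤ q) {K : ℝ}
    (hK : ∀ z, p ≤ z → z ≤ q → u z ≤ K) :
    bx u p q ≤ K * ((q.1 - p.1) * (q.2 - p.2)) := by
  have h1 : ∀ s ∈ Icc p.1 q.1, (∫ t in p.2..q.2, u (s, t)) ≤ K * (q.2 - p.2) := by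
    intro s hs
    have := integral_mono_on (μ := volume) (f := fun t => u (s, t)) (g := fun _ => K) hpq.2
      ((by fun_prop : Continuous fun t => u (s, t)).intervalIntegrable _ _)
      (continuous_const.intervalIntegrable _ _)
      (fun t ht => hK _ ⟨hs.1, ht.1⟩ ⟨hs.2, ht.2⟩)
    simp at this
    linarith
  have := integral_mono_on (μ := volume) (g := fun _ => K * (q.2 - p.2)) hpq.1
      ((inner_cont hu p.2 q.2).intervalIntegrable _ _)
      (continuous_const.intervalIntegrable _ _) h1
  simp at this
  unfold bx
  linarith

lemma le_bx {u : ℝ × ℝ → ℝ} (hu : Continuous u) {p q : ℝ × ℝ} (hpq : p ≤ q) {K : ℝ}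
    (hK : ∀ z, p ≤ z → z ≤ q → K ≤ u z) :
    K * ((q.1 - p.1) * (q.2 - p.2)) ≤ bx u p q := by
  have h := bx_le (u := fun z => - u z) hu.neg hpq (K := -K) (fun z h1 h2 => neg_le_neg (hK z h1 h2))
  have : bx (fun z => - u z) p q = - bx u p q := by simp [bx]
  rw [this] at h
  linarith

lemma bx_diff {u : ℝ × ℝ → ℝ} (hu : Continuous u) {M : ℝ} (hM : ∀ z, |u z| ≤ M)
    {p q p' q' : ℝ × ℝ} {η : ℝ} (h1 : |p.1 - p'.1| ≤ η) (h2 : |p.2 - p'.2| ≤ η)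
    (h3 : |q.1 - q'.1| ≤ η) (h4 : |q.2 - q'.2| ≤ η)
    (h5 : |q.2 - p.2| ≤ 1) (h6 : |q'.1 - p'.1| ≤ 1) :
    |bx u p q - bx u p' q'| ≤ 4 * M * η := by
  have hM0 : 0 ≤ M := (abs_nonneg _).trans (hM 0)
  have hη : 0 ≤ η := (abs_nonneg _).trans h1
  have inn : ∀ c d s, |∫ t in c..d, u (s, t)| ≤ M * |d - c| := fun c d s =>
    intervalIntegral.norm_integral_le_of_norm_le_const (f := fun t => u (s, t)) (C := M)
      (fun t _ => hM _)
  have outr : ∀ a b, |∫ s in a..b, ∫ t in p.2..q.2, u (s, t)| ≤ M * |b - a| := by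
    intro a b
    refine intervalIntegral.norm_integral_le_of_norm_le_const
      (f := fun s => ∫ t in p.2..q.2, u (s, t)) (C := M) (fun s _ => ?_)
    refine (inn _ _ _).trans ?_
    nlinarith
  have ii : ∀ c d a b, IntervalIntegrable (fun s => ∫ t in c..d, u (s, t)) volume a b :=
    fun c d a b => (inner_cont hu c d).intervalIntegrable _ _
  have iu : ∀ s a b, IntervalIntegrable (fun t => u (s, t)) volume a b :=
    fun s a b => (by fun_prop : Continuous fun t => u (s, t)).intervalIntegrable _ _
  have e1 : (∫ s in p.1..q.1, ∫ t in p.2..q.2, u (s, t))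
      - (∫ s in p'.1..q'.1, ∫ t in p.2..q.2, u (s, t))
      = (∫ s in p.1..p'.1, ∫ t in p.2..q.2, u (s, t))
      - (∫ s in q.1..q'.1, ∫ t in p.2..q.2, u (s, t)) :=
    integral_interval_sub_interval_comm (ii _ _ _ _) (ii _ _ _ _) (ii _ _ _ _)
  have e2 : (∫ s in p'.1..q'.1, ∫ t in p.2..q.2, u (s, t)) - bx u p' q'
      = ∫ s in p'.1..q'.1, ((∫ t in p.2..p'.2, u (s, t)) - (∫ t in q.2..q'.2, u (s, t))) := by
    unfold bx
    rw [← intervalIntegral.integral_sub (ii _ _ _ _) (ii _ _ _ _)]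
    congr 1
    ext s
    exact integral_interval_sub_interval_comm (iu _ _ _) (iu _ _ _) (iu _ _ _)
  have b2 : |∫ s in p'.1..q'.1, ((∫ t in p.2..p'.2, u (s, t)) - (∫ t in q.2..q'.2, u (s, t)))|
      ≤ (2 * M * η) * |q'.1 - p'.1| := by
    refine intervalIntegral.norm_integral_le_of_norm_le_const
      (f := fun s => (∫ t in p.2..p'.2, u (s, t)) - (∫ t in q.2..q'.2, u (s, t)))
      (C := 2 * M * η) (fun s _ => ?_)
    have a1 := inn p.2 p'.2 s
    have a2 := inn q.2 q'.2 s
    rw [abs_sub_comm] at h2 h4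
    have := mul_le_mul_of_nonneg_left h2 hM0
    have := mul_le_mul_of_nonneg_left h4 hM0
    refine (norm_sub_le _ _).trans ?_
    simp only [Real.norm_eq_abs]
    linarith
  have o1 := outr p.1 p'.1
  have o2 := outr q.1 q'.1
  rw [abs_sub_comm] at h1 h3
  have := mul_le_mul_of_nonneg_left h1 hM0
  have := mul_le_mul_of_nonneg_left h3 hM0
  have : (2 * M * η) * |q'.1 - p'.1| ≤ 2 * M * η := by
    have : 0 ≤ 2 * M * η := by positivity
    nlinarith
  rw [← e2] at b2
  have e3 : bx u p q = ∫ s in p.1..q.1, ∫ t in p.2..q.2, u (s, t) := rfl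
  rw [← e3] at e1
  simp only [abs_le] at *
  constructor <;> linarith [o1.1, o1.2, o2.1, o2.2, b2.1, b2.2]

lemma sqrt_diff {a b : ℝ} : Real.sqrt b ≤ Real.sqrt a + Real.sqrt |a - b| := by
  rw [Real.sqrt_le_iff]
  refine ⟨by positivity, ?_⟩
  by_cases ha : 0 ≤ a
  · have := Real.sq_sqrt ha
    have := Real.sq_sqrt (abs_nonneg (a - b))
    have := mul_nonneg (Real.sqrt_nonneg a) (Real.sqrt_nonneg |a - b|)
    have := neg_abs_le (a - b)
    have := le_abs_self (a-b)
    nlinarith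
  · have := Real.sq_sqrt (abs_nonneg (a - b))
    rw [Real.sqrt_eq_zero_of_nonpos (by linarith : a ≤ 0)]
    have := neg_abs_le (a - b)
    nlinarith

lemma sqrt_mul_le_half {a b : ℝ} (ha : 0 ≤ a) (hb : 0 ≤ b) : Real.sqrt (a * b) ≤ (a + b) / 2 := by
  rw [Real.sqrt_le_iff]
  constructor
  · positivity
  · nlinarith [sq_nonneg (a - b)]

lemma sum_sqrt_le {n : ℕ} {P : ℕ → ℝ × ℝ} (h0 : P 0 = (0, 0)) (h1 : P n = (1, 1))
    (hm : ∀ k < n, P k ≤ P (k + 1)) :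
    ∑ k ∈ Finset.range n, Real.sqrt (((P (k + 1)).1 - (P k).1) * ((P (k + 1)).2 - (P k).2)) ≤ 1 := by
  have : ∀ k ∈ Finset.range n,
      Real.sqrt (((P (k + 1)).1 - (P k).1) * ((P (k + 1)).2 - (P k).2))
      ≤ ((P (k + 1)).1 + (P (k+1)).2) / 2 - ((P k).1 + (P k).2) / 2 := by
    intro k hk
    have := hm k (Finset.mem_range.1 hk)
    have := sqrt_mul_le_half (sub_nonneg.2 this.1) (sub_nonneg.2 this.2)
    linarith
  refine (Finset.sum_le_sum this).trans ?_
  rw [Finset.sum_range_sub (fun k => ((P k).1 + (P k).2) / 2), h0, h1]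
  norm_num

lemma cs_le {u : ℝ × ℝ → ℝ} (hu : Continuous u) {M : ℝ} (hM : ∀ z, |u z| ≤ M)
    {n : ℕ} {P : ℕ → ℝ × ℝ} (h0 : P 0 = (0, 0)) (h1 : P n = (1, 1))
    (hm : ∀ k < n, P k ≤ P (k + 1)) : cs u n P ≤ 2 * Real.sqrt M := by
  have hM0 : 0 ≤ M := (abs_nonneg _).trans (hM 0)
  unfold cs
  have : ∑ k ∈ Finset.range n, Real.sqrt (bx u (P k) (P (k + 1))) ≤ ∑ k ∈ Finset.range n,
    Real.sqrt M * Real.sqrt (((P (k + 1)).1 - (P k).1) * ((P (k + 1)).2 - (P k).2)) := by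
    apply Finset.sum_le_sum
    intro k hk
    rw [← Real.sqrt_mul hM0]
    apply Real.sqrt_le_sqrt
    exact bx_le hu (hm k (Finset.mem_range.1 hk)) (fun z _ _ => (le_abs_self _).trans (hM z))
  rw [← Finset.mul_sum] at this
  have h2 := sum_sqrt_le h0 h1 hm
  have := mul_le_mul_of_nonneg_left h2 (Real.sqrt_nonneg M)
  linarith

lemma cs_nonneg (u : ℝ × ℝ → ℝ) (n : ℕ) (P : ℕ → ℝ × ℝ) : 0 ≤ cs u n P := by
  unfold cs
  positivity

/-- step function facts -/
lemma step_ii {f : ℕ → ℝ} {C : ℝ} (hf : ∀ k, |f k| ≤ C) (a b : ℝ) :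
    IntervalIntegrable (fun t : ℝ => f ⌊t⌋₊) volume a b := by
  have hm : Measurable (fun t : ℝ => f ⌊t⌋₊) :=
    (measurable_from_nat (f := f)).comp Nat.measurable_floor
  refine IntervalIntegrable.mono_fun (g := fun t : ℝ => f ⌊t⌋₊) (f := fun _ => C)
    (continuous_const.intervalIntegrable _ _) hm.aestronglyMeasurable ?_
  exact Filter.Eventually.of_forall (fun t => (hf _).trans (le_abs_self _))

lemma step_unit (f : ℕ → ℝ) (k : ℕ) : ∫ t in (k : ℝ)..((k + 1 : ℕ) : ℝ), f ⌊t⌋₊ = f k := by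
  have : ∫ t in (k : ℝ)..((k + 1 : ℕ) : ℝ), f ⌊t⌋₊ = ∫ t in (k : ℝ)..((k + 1 : ℕ) : ℝ), f k := by
    apply intervalIntegral.integral_congr_ae
    have : ∀ᵐ t : ℝ, t ≠ ((k + 1 : ℕ) : ℝ) := by
      simp [ae_iff, measure_singleton]
    filter_upwards [this] with t ht h
    rw [uIoc_of_le (by push_cast; linarith)] at h
    have : ⌊t⌋₊ = k := by
      rw [Nat.floor_eq_iff (by have := h.1; have : (0:ℝ) ≤ k := by positivity
                               linarith)]
      refine ⟨h.1.le, ?_⟩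
      have := lt_of_le_of_ne h.2 ht
      push_cast at this
      exact this
    rw [this]
  rw [this]
  simp

lemma step_sum {f : ℕ → ℝ} {C : ℝ} (hf : ∀ k, |f k| ≤ C) (n : ℕ) :
    ∫ t in (0 : ℝ)..(n : ℝ), f ⌊t⌋₊ = ∑ k ∈ Finset.range n, f k := by
  have := sum_integral_adjacent_intervals (μ := volume) (f := fun t : ℝ => f ⌊t⌋₊)
    (a := fun k : ℕ => (k : ℝ)) (n := n) (fun k _ => step_ii hf _ _)
  simp only [Nat.cast_zero] at this
  rw [← this]
  exact Finset.sum_congr rfl (fun k _ => step_unit f k)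

lemma quad_pt {a b h K l : ℝ} (ha : 0 ≤ a) (hb : 0 ≤ b) (hK : 0 ≤ K) (hh : h ^ 2 ≤ K * (a * b)) :
    0 ≤ K * a * (l * l) + (-2 * h) * l + b := by
  have hka : 0 ≤ K * a := mul_nonneg hK ha
  rcases hka.eq_or_lt with h0 | h0
  · have : h = 0 := by
      have : h ^ 2 ≤ 0 := by
        have : K * (a * b) = 0 := by rw [← mul_assoc, ← h0, zero_mul]
        linarith
      nlinarith
    rw [← h0, this]; simpa using hb
  · by_contra hc
    push Not at hc
    have := mul_neg_of_pos_of_neg h0 hc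
    nlinarith [sq_nonneg (K * a * l - h)]

/-- parametrised polygon -/
noncomputable def pX (P : ℕ → ℝ × ℝ) (τ : ℝ) : ℝ :=
  ∫ t in (0 : ℝ)..τ, (fun k : ℕ => (P (k + 1)).1 - (P k).1) ⌊t⌋₊

noncomputable def pY (P : ℕ → ℝ × ℝ) (τ : ℝ) : ℝ :=
  ∫ t in (0 : ℝ)..τ, (fun k : ℕ => (P (k + 1)).2 - (P k).2) ⌊t⌋₊

lemma primitive_mono {f : ℕ → ℝ} {C : ℝ} (hf : ∀ k, |f k| ≤ C) (h0 : ∀ k, 0 ≤ f k) :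
    Monotone (fun τ : ℝ => ∫ t in (0 : ℝ)..τ, f ⌊t⌋₊) := by
  intro a b hab
  have := integral_interval_sub_left (step_ii hf 0 b) (step_ii hf 0 a)
  have h2 : 0 ≤ ∫ t in a..b, f ⌊t⌋₊ := intervalIntegral.integral_nonneg hab (fun t _ => h0 _)
  simp only
  linarith

lemma primitive_cont {f : ℕ → ℝ} {C : ℝ} (hf : ∀ k, |f k| ≤ C) :
    Continuous (fun τ : ℝ => ∫ t in (0 : ℝ)..τ, f ⌊t⌋₊) :=
  intervalIntegral.continuous_primitive (fun a b => step_ii hf a b) 0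

/-- key comparison on an interval -/
lemma key_interval {fa fb fh : ℕ → ℝ} {C : ℝ} (ha : ∀ k, |fa k| ≤ C) (hb : ∀ k, |fb k| ≤ C)
    (hh : ∀ k, |fh k| ≤ C) (ha0 : ∀ k, 0 ≤ fa k) (hb0 : ∀ k, 0 ≤ fb k)
    {s t K : ℝ} (hst : s ≤ t) (hK : 0 ≤ K)
    (hp : ∀ r ∈ Icc s t, fh ⌊r⌋₊ ^ 2 ≤ K * (fa ⌊r⌋₊ * fb ⌊r⌋₊)) :
    (∫ r in s..t, fh ⌊r⌋₊) ≤
      Real.sqrt (K * ((∫ r in s..t, fa ⌊r⌋₊) * (∫ r in s..t, fb ⌊r⌋₊))) := by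
  apply Real.le_sqrt_of_sq_le
  have hq : ∀ l : ℝ, 0 ≤ (K * (∫ r in s..t, fa ⌊r⌋₊)) * (l * l) + (-2 * (∫ r in s..t, fh ⌊r⌋₊)) * l
      + (∫ r in s..t, fb ⌊r⌋₊) := by
    intro l
    have h1 : 0 ≤ ∫ r in s..t, ((K * (l * l)) * fa ⌊r⌋₊ + (-2 * l) * fh ⌊r⌋₊ + fb ⌊r⌋₊) := by
      apply intervalIntegral.integral_nonneg hst
      intro r hr
      have := quad_pt (l := l) (ha0 ⌊r⌋₊) (hb0 ⌊r⌋₊) hK (hp r hr)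
      linarith
    rw [intervalIntegral.integral_add (((step_ii ha s t).const_mul _).add
      ((step_ii hh s t).const_mul _)) (step_ii hb s t),
      intervalIntegral.integral_add ((step_ii ha s t).const_mul _)
      ((step_ii hh s t).const_mul _), intervalIntegral.integral_const_mul,
      intervalIntegral.integral_const_mul] at h1
    linarith
  have := discrim_le_zero hq
  unfold discrim at this
  nlinarith

/-- chain → natural extension of a Fin partition -/
lemma Jpart_eq_cs (u : ℝ × ℝ → ℝ) (n : ℕ) (x y : Fin (n + 1) → ℝ) (P : ℕ → ℝ × ℝ)
    (hP : ∀ k : Fin (n + 1), P k = (x k, y k)) : Jpart u n x y = cs u n P := by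
  unfold Jpart cs bx
  congr 1
  rw [← Fin.sum_univ_eq_sum_range (fun k => Real.sqrt (∫ s in (P k).1..(P (k+1)).1,
    ∫ t in (P k).2..(P (k+1)).2, u (s, t)))]
  refine Finset.sum_congr rfl (fun k _ => ?_)
  have h1 := hP k.castSucc
  have h2 := hP k.succ
  simp only [Fin.val_castSucc, Fin.val_succ] at h1 h2
  rw [h1, h2]

/-- partitions as sequences -/
def IsChain' (Υ : Set (ℝ × ℝ)) (n : ℕ) (Q : ℕ → ℝ × ℝ) : Prop :=
  Monotone Q ∧ Q 0 = (0, 0) ∧ Q n = (1, 1) ∧ ∀ k, Q k ∈ Υ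

lemma partition_to_chain {Υ : Set (ℝ × ℝ)} {n : ℕ} {x y : Fin (n + 1) → ℝ}
    (h : IsPartitionOn 0 1 0 1 Υ n x y) :
    ∃ Q : ℕ → ℝ × ℝ, IsChain' Υ n Q ∧ (∀ k : Fin (n + 1), Q k = (x k, y k)) := by
  obtain ⟨hx, hy, hx0, hy0, hx1, hy1, hU⟩ := h
  refine ⟨fun k => (x ⟨min k n, by omega⟩, y ⟨min k n, by omega⟩), ⟨?_, ?_, ?_, ?_⟩, ?_⟩
  · intro a b hab
    have : (⟨min a n, by omega⟩ : Fin (n+1)) ≤ ⟨min b n, by omega⟩ := by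
      simp only [Fin.mk_le_mk]; omega
    exact ⟨hx this, hy this⟩
  · have : (⟨min 0 n, by omega⟩ : Fin (n+1)) = 0 := by ext; simp
    simp only [this, hx0, hy0]
  · have : (⟨min n n, by omega⟩ : Fin (n+1)) = Fin.last n := by ext; simp
    simp only [this, hx1, hy1]
  · intro k
    exact hU _
  · intro k
    have : (⟨min k n, by omega⟩ : Fin (n+1)) = k := by ext; simp; omega
    simp only [this]

lemma chain_to_partition {Υ : Set (ℝ × ℝ)} {n : ℕ} {Q : ℕ → ℝ × ℝ}
    (h : IsChain' Υ n Q) :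
    IsPartitionOn 0 1 0 1 Υ n (fun k => (Q k).1) (fun k => (Q k).2) := by
  obtain ⟨hm, h0, h1, hU⟩ := h
  refine ⟨fun a b hab => (hm hab).1, fun a b hab => (hm hab).2, ?_, ?_, ?_, ?_, ?_⟩
  · simp [h0]
  · simp [h0]
  · simp [h1]
  · simp [h1]
  · intro k; exact hU _

/-- the set whose infimum is taken -/
lemma Jset_le {u : ℝ × ℝ → ℝ} (hu : Continuous u) {M : ℝ} (hM : ∀ z, |u z| ≤ M)
    (Υ : Set (ℝ × ℝ)) (ε : ℝ) :
    sInf {r : ℝ | ∃ (n : ℕ) (x y : Fin (n + 1) → ℝ),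
      IsPartitionOn 0 1 0 1 Υ n x y ∧
      (∀ k : Fin n, x k.succ - x k.castSucc < (ε : ℝ) ∧ y k.succ - y k.castSucc < (ε : ℝ)) ∧
      r = Jpart u n x y} ≤ 2 * Real.sqrt M := by
  set S := {r : ℝ | ∃ (n : ℕ) (x y : Fin (n + 1) → ℝ),
      IsPartitionOn 0 1 0 1 Υ n x y ∧
      (∀ k : Fin n, x k.succ - x k.castSucc < (ε : ℝ) ∧ y k.succ - y k.castSucc < (ε : ℝ)) ∧
      r = Jpart u n x y} with hS
  have hb : BddBelow S := by
    refine ⟨0, ?_⟩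
    rintro r ⟨n, x, y, -, -, rfl⟩
    unfold Jpart; positivity
  rcases S.eq_empty_or_nonempty with h | ⟨r, hr⟩
  · rw [h, Real.sInf_empty]; positivity
  · refine (csInf_le hb hr).trans ?_
    obtain ⟨n, x, y, h1, -, rfl⟩ := hr
    obtain ⟨Q, ⟨a, b, c, d⟩, e⟩ := partition_to_chain h1
    rw [Jpart_eq_cs u n x y Q e]
    exact cs_le hu hM b c (fun k _ => a (Nat.le_succ k))

lemma Jcurve_bdd {u : ℝ × ℝ → ℝ} (hu : Continuous u) {M : ℝ} (hM : ∀ z, |u z| ≤ M)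
    (Υ : Set (ℝ × ℝ)) : Jcurve 0 1 0 1 u Υ ≤ 2 * Real.sqrt M := by
  unfold Jcurve
  have : Nonempty {e : ℝ // 0 < e} := ⟨⟨1, one_pos⟩⟩
  exact ciSup_le (fun ε => Jset_le hu hM Υ ε)

/-- To bound `Jcurve` below. -/
lemma le_Jcurve {u : ℝ × ℝ → ℝ} (hu : Continuous u) {M : ℝ} (hM : ∀ z, |u z| ≤ M)
    (Υ : Set (ℝ × ℝ)) {ε c : ℝ} (hε : 0 < ε)
    (hne : ∃ n Q, IsChain' Υ n Q ∧ ∀ k < n, (Q (k+1)).1 - (Q k).1 < ε ∧ (Q (k+1)).2 - (Q k).2 < ε)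
    (h : ∀ n Q, IsChain' Υ n Q → (∀ k < n, (Q (k+1)).1 - (Q k).1 < ε ∧ (Q (k+1)).2 - (Q k).2 < ε) →
      c ≤ cs u n Q) : c ≤ Jcurve 0 1 0 1 u Υ := by
  unfold Jcurve
  refine le_ciSup_of_le ⟨2 * Real.sqrt M, ?_⟩ ⟨ε, hε⟩ ?_
  · rintro _ ⟨e, rfl⟩
    exact Jset_le hu hM Υ e
  · apply le_csInf
    · obtain ⟨n, Q, h1, h2⟩ := hne
      exact ⟨_, n, _, _, chain_to_partition h1, fun k => h2 k k.2, rfl⟩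
    · rintro _ ⟨n, x, y, h1, h2, rfl⟩
      obtain ⟨Q, a, e⟩ := partition_to_chain h1
      rw [Jpart_eq_cs u n x y Q e]
      refine h n Q a (fun k hk => ?_)
      have e1 := e (⟨k, hk⟩ : Fin n).castSucc
      have e2 := e (⟨k, hk⟩ : Fin n).succ
      simp only [Fin.val_castSucc, Fin.val_succ] at e1 e2
      rw [e1, e2]
      exact h2 ⟨k, hk⟩

/-- To bound `Jcurve` above. -/
lemma Jcurve_lt {u : ℝ × ℝ → ℝ} {Υ : Set (ℝ × ℝ)} {c : ℝ} (h : c < Jcurve 0 1 0 1 u Υ) :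
    ∃ ε > 0, ∀ n Q, IsChain' Υ n Q →
      (∀ k < n, (Q (k+1)).1 - (Q k).1 < ε ∧ (Q (k+1)).2 - (Q k).2 < ε) → c < cs u n Q := by
  unfold Jcurve at h
  have : Nonempty {e : ℝ // 0 < e} := ⟨⟨1, one_pos⟩⟩
  obtain ⟨⟨ε, hε⟩, h⟩ := exists_lt_of_lt_ciSup h
  refine ⟨ε, hε, fun n Q h1 h2 => h.trans_le ?_⟩
  apply csInf_le
  · refine ⟨0, ?_⟩
    rintro r ⟨n, x, y, -, -, rfl⟩
    unfold Jpart; positivity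
  · exact ⟨n, _, _, chain_to_partition h1, fun k => h2 k k.2,
      (Jpart_eq_cs u n _ _ Q (fun k => rfl)).symm⟩

/-- polygon -/
noncomputable def poly (P : ℕ → ℝ × ℝ) (n : ℕ) : Set (ℝ × ℝ) :=
  (fun τ => (pX P τ, pY P τ)) '' Icc (0 : ℝ) n

structure GoodChain (P : ℕ → ℝ × ℝ) (n : ℕ) : Prop where
  mono : Monotone P
  zero : P 0 = (0, 0)
  top : ∀ k, n ≤ k → P k = (1, 1)

namespace GoodChain
variable {P : ℕ → ℝ × ℝ} {n : ℕ}

lemma mem (h : GoodChain P n) (k : ℕ) : (0, 0) ≤ P k ∧ P k ≤ (1, 1) := by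
  refine ⟨h.zero ▸ h.mono (Nat.zero_le k), ?_⟩
  rw [← h.top (max k n) (le_max_right _ _)]
  exact h.mono (le_max_left _ _)

lemma dx0 (h : GoodChain P n) (k : ℕ) : 0 ≤ (P (k + 1)).1 - (P k).1 :=
  sub_nonneg.2 (h.mono (Nat.le_succ k)).1
lemma dy0 (h : GoodChain P n) (k : ℕ) : 0 ≤ (P (k + 1)).2 - (P k).2 :=
  sub_nonneg.2 (h.mono (Nat.le_succ k)).2
lemma dx1 (h : GoodChain P n) (k : ℕ) : |(P (k + 1)).1 - (P k).1| ≤ 1 := by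
  rw [abs_of_nonneg (h.dx0 k)]
  linarith [(h.mem k).1.1, (h.mem (k+1)).2.1]
lemma dy1 (h : GoodChain P n) (k : ℕ) : |(P (k + 1)).2 - (P k).2| ≤ 1 := by
  rw [abs_of_nonneg (h.dy0 k)]
  linarith [(h.mem k).1.2, (h.mem (k+1)).2.2]

lemma pX_mono (h : GoodChain P n) : Monotone (pX P) :=
  primitive_mono (f := fun k : ℕ => (P (k + 1)).1 - (P k).1) h.dx1 h.dx0
lemma pY_mono (h : GoodChain P n) : Monotone (pY P) :=
  primitive_mono (f := fun k : ℕ => (P (k + 1)).2 - (P k).2) h.dy1 h.dy0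
lemma pX_cont (h : GoodChain P n) : Continuous (pX P) :=
  primitive_cont (f := fun k : ℕ => (P (k + 1)).1 - (P k).1) h.dx1
lemma pY_cont (h : GoodChain P n) : Continuous (pY P) :=
  primitive_cont (f := fun k : ℕ => (P (k + 1)).2 - (P k).2) h.dy1
lemma pX_nat (h : GoodChain P n) (k : ℕ) : pX P k = (P k).1 := by
  unfold pX
  rw [step_sum (f := fun k : ℕ => (P (k + 1)).1 - (P k).1) h.dx1,
    Finset.sum_range_sub (fun k => (P k).1), h.zero]
  simp
lemma pY_nat (h : GoodChain P n) (k : ℕ) : pY P k = (P k).2 := by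
  unfold pY
  rw [step_sum (f := fun k : ℕ => (P (k + 1)).2 - (P k).2) h.dy1,
    Finset.sum_range_sub (fun k => (P k).2), h.zero]
  simp
lemma pX_sub (h : GoodChain P n) (a b : ℝ) :
    ∫ t in a..b, (fun k : ℕ => (P (k + 1)).1 - (P k).1) ⌊t⌋₊ = pX P b - pX P a :=
  (integral_interval_sub_left (step_ii h.dx1 0 b) (step_ii h.dx1 0 a)).symm
lemma pY_sub (h : GoodChain P n) (a b : ℝ) :
    ∫ t in a..b, (fun k : ℕ => (P (k + 1)).2 - (P k).2) ⌊t⌋₊ = pY P b - pY P a :=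
  (integral_interval_sub_left (step_ii h.dy1 0 b) (step_ii h.dy1 0 a)).symm

lemma pXY_zero (h : GoodChain P n) : (pX P 0, pY P 0) = ((0 : ℝ), (0 : ℝ)) := by
  have h1 := h.pX_nat 0
  have h2 := h.pY_nat 0
  simp only [Nat.cast_zero, h.zero] at h1 h2
  rw [h1, h2]
lemma pXY_top (h : GoodChain P n) : (pX P n, pY P n) = ((1 : ℝ), (1 : ℝ)) := by
  rw [h.pX_nat, h.pY_nat, h.top n le_rfl]

lemma poly_mem (h : GoodChain P n) : poly P n ∈ Bup 0 1 0 1 := by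
  refine ⟨?_, ?_, ?_, ?_, ?_⟩
  · rintro _ ⟨τ, hτ, rfl⟩
    have a := h.pXY_zero
    have b := h.pXY_top
    simp only [← a, ← b]
    exact ⟨⟨h.pX_mono hτ.1, h.pY_mono hτ.1⟩, ⟨h.pX_mono hτ.2, h.pY_mono hτ.2⟩⟩
  · exact (isConnected_Icc (Nat.cast_nonneg n)).image _
      (h.pX_cont.prodMk h.pY_cont).continuousOn
  · exact ⟨0, ⟨le_rfl, Nat.cast_nonneg n⟩, h.pXY_zero⟩
  · exact ⟨n, ⟨Nat.cast_nonneg n, le_rfl⟩, h.pXY_top⟩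
  · rintro _ ⟨s, hs, rfl⟩ _ ⟨t, ht, rfl⟩
    rcases le_total s t with hst | hst
    · exact mul_nonneg_of_nonpos_of_nonpos (sub_nonpos.2 (h.pX_mono hst)) (sub_nonpos.2 (h.pY_mono hst))
    · exact mul_nonneg (sub_nonneg.2 (h.pX_mono hst)) (sub_nonneg.2 (h.pY_mono hst))

/-- monotone parameters of a chain on the polygon -/
lemma params (h : GoodChain P n) {n' : ℕ} {Q : ℕ → ℝ × ℝ} (hQ : IsChain' (poly P n) n' Q) :
    ∃ τ : ℕ → ℝ, Monotone τ ∧ τ 0 = 0 ∧ τ n' = n ∧ (∀ k, 0 ≤ τ k) ∧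
      ∀ k, Q k = (pX P (τ k), pY P (τ k)) := by
  classical
  have hex : ∀ p ∈ poly P n, ∃ τ ∈ Icc (0 : ℝ) n, (pX P τ, pY P τ) = p := fun p hp => hp
  choose! s hs1 hs2 using hex
  let g : ℝ × ℝ → ℝ := fun p => if p = (0, 0) then 0 else if p = (1, 1) then n else s p
  have hg1 : ∀ p ∈ poly P n, (pX P (g p), pY P (g p)) = p := by
    intro p hp
    simp only [g]
    split_ifs with a b
    · rw [a, h.pXY_zero]
    · rw [b, h.pXY_top]
    · exact hs2 p hp
  have hg0 : ∀ p ∈ poly P n, 0 ≤ g p := by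
    intro p hp
    simp only [g]
    split_ifs with a b
    · exact le_rfl
    · positivity
    · exact (hs1 p hp).1
  obtain ⟨q1, q2, q3, q4⟩ := hQ
  refine ⟨fun k => g (Q k), ?_, ?_, ?_, fun k => hg0 _ (q4 k), fun k => (hg1 _ (q4 k)).symm⟩
  · intro a b hab
    have hle := q1 hab
    by_contra hc
    simp only [not_le] at hc
    have : Q b ≤ Q a := by
      rw [← hg1 _ (q4 a), ← hg1 _ (q4 b)]
      exact ⟨h.pX_mono hc.le, h.pY_mono hc.le⟩
    rw [le_antisymm hle this] at hc
    exact lt_irrefl _ hc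
  · simp [g, q2]
  · simp [g, q3]

/-- main comparison -/
lemma compare (h : GoodChain P n) {u : ℝ × ℝ → ℝ} (hu : Continuous u) (hu0 : ∀ z, 0 ≤ u z)
    {M : ℝ} (hM : ∀ z, |u z| ≤ M) {ω δ : ℝ} (hω : 0 < ω)
    (hmod : ∀ p ∈ Icc ((0:ℝ),(0:ℝ)) (1,1), ∀ q ∈ Icc ((0:ℝ),(0:ℝ)) (1,1), |p.1 - q.1| < δ → |p.2 - q.2| < δ →
      |u p - u q| ≤ ω)
    (hmesh : ∀ k, (P (k+1)).1 - (P k).1 < δ ∧ (P (k+1)).2 - (P k).2 < δ)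
    {n' : ℕ} {Q : ℕ → ℝ × ℝ} (hQ : IsChain' (poly P n) n' Q)
    (hQmesh : ∀ k < n', (Q (k+1)).1 - (Q k).1 < δ ∧ (Q (k+1)).2 - (Q k).2 < δ) :
    cs u n P - 2 * Real.sqrt (3 * ω) ≤ cs u n' Q := by
  have hM0 : 0 ≤ M := (abs_nonneg _).trans (hM 0)
  obtain ⟨τ, t1, t2, t3, t4, t5⟩ := h.params hQ
  set fh : ℕ → ℝ := fun k => Real.sqrt (bx u (P k) (P (k + 1))) with hfh
  set C : ℝ := max 1 (Real.sqrt M)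
  have hbox : ∀ p, p ∈ poly P n → p ∈ Icc ((0:ℝ),(0:ℝ)) (1,1) := fun p hp => h.poly_mem.1 hp
  have hfhb : ∀ k, |fh k| ≤ C := by
    intro k
    rw [abs_of_nonneg (Real.sqrt_nonneg _)]
    refine le_trans ?_ (le_max_right _ _)
    apply Real.sqrt_le_sqrt
    refine (bx_le hu (h.mono (Nat.le_succ k)) (K := M)
      (fun z _ _ => (le_abs_self _).trans (hM z))).trans ?_
    have a1 := h.dx1 k
    have a2 := h.dy1 k
    rw [abs_of_nonneg (h.dx0 k)] at a1
    rw [abs_of_nonneg (h.dy0 k)] at a2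
    have := mul_le_one₀ a1 (h.dy0 k) a2
    nlinarith
  have hsum : ∑ j ∈ Finset.range n', ∫ r in (τ j)..(τ (j+1)), fh ⌊r⌋₊
      = ∑ k ∈ Finset.range n, fh k := by
    rw [sum_integral_adjacent_intervals (μ := volume) (f := fun t : ℝ => fh ⌊t⌋₊)
      (a := τ) (n := n') (fun k _ => step_ii hfhb _ _), t2, t3, step_sum hfhb]
  have hcell : ∀ j ∈ Finset.range n', (∫ r in (τ j)..(τ (j+1)), fh ⌊r⌋₊) ≤
      Real.sqrt (bx u (Q j) (Q (j+1))) + Real.sqrt (3 * ω) *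
        Real.sqrt (((Q (j + 1)).1 - (Q j).1) * ((Q (j + 1)).2 - (Q j).2)) := by
    intro j hj
    have hj' := hQmesh j (Finset.mem_range.1 hj)
    have hle : Q j ≤ Q (j+1) := hQ.1 (Nat.le_succ j)
    have hQj := hbox _ (hQ.2.2.2 j)
    have hQj1 := hbox _ (hQ.2.2.2 (j+1))
    have hk := key_interval (fa := fun k : ℕ => (P (k + 1)).1 - (P k).1)
      (fb := fun k : ℕ => (P (k + 1)).2 - (P k).2) (fh := fh) (C := C)
      (fun k => (h.dx1 k).trans (le_max_left _ _)) (fun k => (h.dy1 k).trans (le_max_left _ _))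
      hfhb h.dx0 h.dy0 (t1 (Nat.le_succ j)) (K := u (Q j) + 2 * ω)
      (by linarith [hu0 (Q j)]) ?_
    · rw [h.pX_sub, h.pY_sub] at hk
      have e1 : pX P (τ (j+1)) - pX P (τ j) = (Q (j+1)).1 - (Q j).1 := by rw [t5, t5]
      have e2 : pY P (τ (j+1)) - pY P (τ j) = (Q (j+1)).2 - (Q j).2 := by rw [t5, t5]
      rw [Nat.succ_eq_add_one, e1, e2] at hk
      refine hk.trans ?_
      have hl := le_bx hu hle (K := u (Q j) - ω) (by
        intro z hz1 hz2
        have hz : z ∈ Icc ((0:ℝ),(0:ℝ)) (1,1) := ⟨hQj.1.trans hz1, hz2.trans hQj1.2⟩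
        have := hmod z hz (Q j) hQj
          (by rw [abs_of_nonneg (sub_nonneg.2 hz1.1)]; linarith [hz2.1])
          (by rw [abs_of_nonneg (sub_nonneg.2 hz1.2)]; linarith [hz2.2])
        linarith [(abs_le.1 this).1])
      set D := ((Q (j + 1)).1 - (Q j).1) * ((Q (j + 1)).2 - (Q j).2) with hD
      have hD0 : 0 ≤ D := mul_nonneg (sub_nonneg.2 hle.1) (sub_nonneg.2 hle.2)
      have hb0 : 0 ≤ bx u (Q j) (Q (j+1)) := by
        have := le_bx hu hle (K := 0) (fun z _ _ => hu0 z)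
        linarith
      rw [← Real.sqrt_mul (by positivity)]
      refine (Real.sqrt_le_sqrt (?_ : _ ≤ bx u (Q j) (Q (j+1)) + 3 * ω * D)).trans ?_
      · nlinarith
      · have := sqrt_diff (a := bx u (Q j) (Q (j+1))) (b := bx u (Q j) (Q (j+1)) + 3 * ω * D)
        rwa [abs_sub_comm, add_sub_cancel_left, abs_of_nonneg (by positivity : 0 ≤ 3 * ω * D)] at this
    · intro r hr
      have hr0 : 0 ≤ r := (t4 j).trans hr.1
      set k := ⌊r⌋₊ with hk
      have k1 : (k : ℝ) ≤ r := Nat.floor_le hr0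
      have k2 : r ≤ ((k + 1 : ℕ) : ℝ) := by push_cast; exact (Nat.lt_floor_add_one r).le
      set w : ℝ × ℝ := (pX P r, pY P r) with hw
      have w1 : P k ≤ w := ⟨h.pX_nat k ▸ h.pX_mono k1, h.pY_nat k ▸ h.pY_mono k1⟩
      have w2 : w ≤ P (k+1) := ⟨h.pX_nat (k+1) ▸ h.pX_mono k2, h.pY_nat (k+1) ▸ h.pY_mono k2⟩
      have w3 : Q j ≤ w := by rw [t5]; exact ⟨h.pX_mono hr.1, h.pY_mono hr.1⟩
      have w4 : w ≤ Q (j+1) := by rw [t5]; exact ⟨h.pX_mono hr.2, h.pY_mono hr.2⟩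
      have hwb : w ∈ Icc ((0:ℝ),(0:ℝ)) (1,1) := ⟨hQj.1.trans w3, w4.trans hQj1.2⟩
      have hb0 : 0 ≤ bx u (P k) (P (k+1)) := by
        have := le_bx hu (h.mono (Nat.le_succ k)) (K := 0) (fun z _ _ => hu0 z)
        rw [Nat.succ_eq_add_one] at this
        linarith
      rw [hfh]
      simp only
      rw [Real.sq_sqrt hb0]
      refine bx_le hu (h.mono (Nat.le_succ k)) ?_
      intro z hz1 hz2
      have hz : z ∈ Icc ((0:ℝ),(0:ℝ)) (1,1) := ⟨(h.mem k).1.trans hz1, hz2.trans (h.mem (k+1)).2⟩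
      have m1 := hmesh k
      have A := hmod z hz w hwb
        (by rw [abs_lt]; constructor <;> linarith [hz1.1, hz2.1, w1.1, w2.1, m1.1])
        (by rw [abs_lt]; constructor <;> linarith [hz1.2, hz2.2, w1.2, w2.2, m1.2])
      have B := hmod w hwb (Q j) hQj
          (by rw [abs_of_nonneg (sub_nonneg.2 w3.1)]; linarith [w4.1])
          (by rw [abs_of_nonneg (sub_nonneg.2 w3.2)]; linarith [w4.2])
      linarith [(abs_le.1 A).2, (abs_le.1 B).2]
  have hs := Finset.sum_le_sum hcell
  rw [hsum, Finset.sum_add_distrib, ← Finset.mul_sum] at hs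
  have h2 := sum_sqrt_le hQ.2.1 hQ.2.2.1 (fun k _ => hQ.1 (Nat.le_succ k))
  have := mul_le_mul_of_nonneg_left h2 (Real.sqrt_nonneg (3 * ω))
  unfold cs
  linarith

end GoodChain

/-- refined path with real positions -/
structure RealPath (N : ℕ) where
  i : ℕ → ℕ
  j : ℕ → ℕ
  t : ℕ → ℝ
  start_i : i 1 = 1
  start_j : j 1 = 1
  stop_i : i (2 * N - 1) = N
  stop_j : j (2 * N - 1) = N
  step : ∀ k, 1 ≤ k → k ≤ 2 * N - 2 →
    (i (k + 1) = i k + 1 ∧ j (k + 1) = j k) ∨ (i (k + 1) = i k ∧ j (k + 1) = j k + 1)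
  t_mem : ∀ k, 1 ≤ k → k ≤ 2 * N - 2 → 0 ≤ t k ∧ t k ≤ 1
  t_mono : ∀ k, 1 ≤ k → k ≤ 2 * N - 3 →
    ((i k = i (k + 1) ∧ i (k + 1) = i (k + 2)) ∨ (j k = j (k + 1) ∧ j (k + 1) = j (k + 2))) →
    t k ≤ t (k + 1)

namespace RealPath
variable {N : ℕ}

noncomputable def center (R : RealPath N) (k : ℕ) : ℝ × ℝ :=
  if R.i (k + 1) = R.i k + 1 then
    ((R.i k : ℝ) / N, ((R.j k : ℝ) - 1 + R.t k) / N)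
  else
    (((R.i k : ℝ) - 1 + R.t k) / N, (R.j k : ℝ) / N)

noncomputable def pt (R : RealPath N) (k : ℕ) : ℝ × ℝ :=
  if k = 0 then (0, 0) else if k = 2 * N - 1 then (1, 1) else R.center k

noncomputable def lo (R : RealPath N) (k : ℕ) : ℝ × ℝ :=
  (((R.i k : ℝ) - 1) / N, ((R.j k : ℝ) - 1) / N)
noncomputable def hi (R : RealPath N) (k : ℕ) : ℝ × ℝ :=
  ((R.i k : ℝ) / N, (R.j k : ℝ) / N)

lemma center_cases (R : RealPath N) {k : ℕ} (h1 : 1 ≤ k) (h2 : k ≤ 2 * N - 2) :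
    (R.i (k + 1) = R.i k + 1 ∧ R.j (k + 1) = R.j k ∧
      R.pt k = ((R.i k : ℝ) / N, ((R.j k : ℝ) - 1 + R.t k) / N)) ∨
    (R.i (k + 1) = R.i k ∧ R.j (k + 1) = R.j k + 1 ∧
      R.pt k = (((R.i k : ℝ) - 1 + R.t k) / N, (R.j k : ℝ) / N)) := by
  have e : R.pt k = R.center k := by
    unfold pt
    rw [if_neg (by omega), if_neg (by omega)]
  rw [e]
  rcases R.step k h1 h2 with ⟨a, b⟩ | ⟨a, b⟩
  · left
    refine ⟨a, b, ?_⟩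
    unfold center
    rw [if_pos a]
  · right
    refine ⟨a, b, ?_⟩
    unfold center
    rw [if_neg (by omega)]

lemma pt_zero (R : RealPath N) : R.pt 0 = (0, 0) := by simp [pt]
lemma pt_top (R : RealPath N) (hN : 1 ≤ N) : R.pt (2 * N - 1) = (1, 1) := by
  unfold pt
  rw [if_neg (by omega), if_pos rfl]

lemma dle {N : ℕ} {a b : ℝ} (h : a ≤ b) : a / (N : ℝ) ≤ b / N :=
  div_le_div_of_nonneg_right h (Nat.cast_nonneg N)

lemma pt_box (R : RealPath N) (hN : 1 ≤ N) {k : ℕ} (h1 : 1 ≤ k) (h2 : k ≤ 2 * N - 1) :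
    R.lo k ≤ R.pt k ∧ R.pt k ≤ R.hi k := by
  have hN' : (N : ℝ) ≠ 0 := by positivity
  rcases h2.eq_or_lt with h | h
  · subst h
    rw [R.pt_top hN]
    unfold lo hi
    rw [R.stop_i, R.stop_j, div_self hN']
    have : ((N : ℝ) - 1) / N ≤ 1 := by
      rw [div_le_one (by positivity)]; linarith
    exact ⟨⟨this, this⟩, le_rfl⟩
  · have ht := R.t_mem k h1 (by omega)
    unfold lo hi
    rcases R.center_cases h1 (by omega) with ⟨-, -, e⟩ | ⟨-, -, e⟩ <;> rw [e]
    · exact ⟨⟨dle (by linarith), dle (by linarith)⟩, ⟨dle (by linarith), dle (by linarith)⟩⟩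
    · exact ⟨⟨dle (by linarith), dle (by linarith)⟩, ⟨dle (by linarith), dle (by linarith)⟩⟩

lemma pt_box' (R : RealPath N) {k : ℕ} (h2 : k < 2 * N - 1) :
    R.lo (k + 1) ≤ R.pt k ∧ R.pt k ≤ R.hi (k + 1) := by
  rcases Nat.eq_zero_or_pos k with h | h
  · subst h
    rw [R.pt_zero]
    unfold lo hi
    simp only [zero_add]
    rw [R.start_i, R.start_j]
    constructor
    · simp
    · exact ⟨by positivity, by positivity⟩
  · have ht := R.t_mem k h (by omega)
    unfold lo hi
    rcases R.center_cases h (by omega) with ⟨a, b, e⟩ | ⟨a, b, e⟩ <;> rw [e, a, b] <;> push_cast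
    · exact ⟨⟨dle (by linarith), dle (by linarith)⟩, ⟨dle (by linarith), dle (by linarith)⟩⟩
    · exact ⟨⟨dle (by linarith), dle (by linarith)⟩, ⟨dle (by linarith), dle (by linarith)⟩⟩

lemma pt_mono (R : RealPath N) (hN : 1 ≤ N) {k : ℕ} (h2 : k < 2 * N - 1) :
    R.pt k ≤ R.pt (k + 1) := by
  have A := R.pt_box' h2
  have B := R.pt_box hN (k := k + 1) (by omega) (by omega)
  rcases Nat.eq_zero_or_pos k with h | h
  · subst h
    refine le_trans ?_ B.1
    rw [R.pt_zero]
    unfold lo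
    simp only [zero_add]
    rw [R.start_i, R.start_j]
    simp
  rcases (Nat.succ_le_of_lt h2).eq_or_lt with h' | h'
  · refine A.2.trans ?_
    rw [Nat.succ_eq_add_one] at h'
    rw [h', R.pt_top hN]
    unfold hi
    rw [R.stop_i, R.stop_j, div_self (by positivity)]
  · have hm := R.t_mono k h (by omega)
    rcases R.center_cases h (by omega) with ⟨a, b, e⟩ | ⟨a, b, e⟩ <;>
    rcases R.center_cases (k := k + 1) (by omega) (by omega) with ⟨a', b', e'⟩ | ⟨a', b', e'⟩
    · have := hm (Or.inr ⟨b.symm, b'.symm⟩)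
      rw [e, e', a, b]
      push_cast
      exact ⟨dle (by linarith), dle (by linarith)⟩
    · refine ⟨?_, ?_⟩
      · refine le_trans ?_ B.1.1
        rw [e]; unfold lo; rw [a]; push_cast
        exact dle (by linarith)
      · refine A.2.2.trans ?_
        rw [e']; unfold hi
        exact le_rfl
    · refine ⟨?_, ?_⟩
      · refine A.2.1.trans ?_
        rw [e']; unfold hi
        exact le_rfl
      · refine le_trans ?_ B.1.2
        rw [e]; unfold lo; rw [b]; push_cast
        exact dle (by linarith)
    · have := hm (Or.inl ⟨a.symm, a'.symm⟩)
      rw [e, e', a, b]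
      push_cast
      exact ⟨dle (by linarith), dle (by linarith)⟩

lemma pt_mesh (R : RealPath N) (hN : 1 ≤ N) {k : ℕ} (h2 : k < 2 * N - 1) :
    (R.pt (k + 1)).1 - (R.pt k).1 ≤ 1 / N ∧ (R.pt (k + 1)).2 - (R.pt k).2 ≤ 1 / N := by
  have A := R.pt_box' h2
  have B := R.pt_box hN (k := k + 1) (by omega) (by omega)
  have a := A.1.1
  have b := A.1.2
  have c := B.2.1
  have d := B.2.2
  unfold lo at a b
  unfold hi at c d
  simp only [sub_div] at a b
  constructor <;> linarith

/-- extended chain -/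
noncomputable def ch (R : RealPath N) (k : ℕ) : ℝ × ℝ := R.pt (min k (2 * N - 1))

lemma good (R : RealPath N) (hN : 1 ≤ N) : GoodChain R.ch (2 * N - 1) := by
  refine ⟨monotone_nat_of_le_succ ?_, ?_, ?_⟩
  · intro k
    unfold ch
    rcases lt_or_ge k (2 * N - 1) with h | h
    · rw [min_eq_left h.le, min_eq_left h]
      exact R.pt_mono hN h
    · rw [min_eq_right h, min_eq_right (by omega)]
  · unfold ch; simp [R.pt_zero]
  · intro k hk
    unfold ch
    rw [min_eq_right hk, R.pt_top hN]

lemma ch_mesh (R : RealPath N) (hN : 1 ≤ N) (k : ℕ) :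
    (R.ch (k + 1)).1 - (R.ch k).1 ≤ 1 / N ∧ (R.ch (k + 1)).2 - (R.ch k).2 ≤ 1 / N := by
  unfold ch
  rcases lt_or_ge k (2 * N - 1) with h | h
  · rw [min_eq_left h.le, min_eq_left h]
    exact R.pt_mesh hN h
  · rw [min_eq_right h, min_eq_right (by omega)]
    simp

lemma ch_eq (R : RealPath N) {k : ℕ} (h : k ≤ 2 * N - 1) : R.ch k = R.pt k := by
  unfold ch; rw [min_eq_left h]

noncomputable def sum (u : ℝ × ℝ → ℝ) (R : RealPath N) : ℝ := cs u (2 * N - 1) R.ch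

lemma sum_le {u : ℝ × ℝ → ℝ} (hu : Continuous u) {M : ℝ} (hM : ∀ z, |u z| ≤ M)
    (hN : 1 ≤ N) (R : RealPath N) : R.sum u ≤ 2 * Real.sqrt M :=
  cs_le hu hM (R.good hN).zero ((R.good hN).top _ le_rfl) (fun k _ => (R.good hN).mono (Nat.le_succ k))

end RealPath

/-- refined paths are real paths -/
noncomputable def RefinedPath.toReal {N m : ℕ} (Γ : RefinedPath N m) : RealPath N where
  i := Γ.i
  j := Γ.j
  t := fun k => ((Γ.r k : ℝ) - 1 / 2) / m
  start_i := Γ.start_i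
  start_j := Γ.start_j
  stop_i := Γ.stop_i
  stop_j := Γ.stop_j
  step := Γ.step
  t_mem := by
    intro k h1 h2
    obtain ⟨a, b⟩ := Γ.r_mem k h1 h2
    have a' : (1 : ℝ) ≤ Γ.r k := by exact_mod_cast a
    have b' : (Γ.r k : ℝ) ≤ m := by exact_mod_cast b
    constructor
    · apply div_nonneg <;> linarith
    · rw [div_le_one (by linarith)]; linarith
  t_mono := by
    intro k h1 h2 h
    have : (Γ.r k : ℝ) ≤ Γ.r (k + 1) := by exact_mod_cast Γ.r_mono k h1 h2 h
    exact RealPath.dle (by linarith)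

lemma RefinedPath.toReal_pt {N m : ℕ} (Γ : RefinedPath N m) (k : ℕ) : Γ.toReal.pt k = Γ.pt k := by
  unfold RealPath.pt RefinedPath.pt RealPath.center RefinedPath.center RefinedPath.toReal
  simp only [add_div, div_div]

lemma pathSum_eq {u : ℝ × ℝ → ℝ} {N m : ℕ} (Γ : RefinedPath N m) :
    pathSum u N m Γ = Γ.toReal.sum u := by
  unfold pathSum RealPath.sum cs bx
  congr 1
  have : Finset.Icc 1 (2 * N - 1) = Finset.Ico 1 (2 * N - 1 + 1) := by ext; simp
  rw [this, Finset.sum_Ico_eq_sum_range]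
  refine Finset.sum_congr (by simp) (fun k hk => ?_)
  have hk := Finset.mem_range.1 hk
  rw [Γ.toReal.ch_eq (by omega), Γ.toReal.ch_eq (by omega), Γ.toReal_pt, Γ.toReal_pt,
    Nat.add_sub_cancel_left, add_comm 1 k]

lemma disc {m : ℕ} (hm : 1 ≤ m) {t : ℝ} (h0 : 0 ≤ t) (h1 : t ≤ 1) :
    |(((min m (⌊m * t⌋₊ + 1) : ℕ) : ℝ) - 1 / 2) / m - t| ≤ 1 / m := by
  have hm0 : (0 : ℝ) < m := by positivity
  have e : (((min m (⌊m * t⌋₊ + 1) : ℕ) : ℝ) - 1 / 2) / m - t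
    = (((min m (⌊m * t⌋₊ + 1) : ℕ) : ℝ) - 1 / 2 - m * t) / m := by field_simp
  rw [e, abs_div, abs_of_pos hm0]
  refine RealPath.dle ?_
  have a := Nat.floor_le (by positivity : 0 ≤ m * t)
  have b := Nat.lt_floor_add_one (m * t)
  rcases le_total m (⌊m * t⌋₊ + 1) with h | h
  · rw [min_eq_left h]
    have h' : (m : ℝ) ≤ ⌊m * t⌋₊ + 1 := by exact_mod_cast h
    have : m * t ≤ m := by nlinarith
    rw [abs_le]; constructor <;> linarith
  · rw [min_eq_right h]
    push_cast
    rw [abs_le]; constructor <;> linarith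

noncomputable def RealPath.toRefined {N : ℕ} (R : RealPath N) {m : ℕ} (hm : 1 ≤ m) :
    RefinedPath N m where
  i := R.i
  j := R.j
  r := fun k => min m (⌊m * R.t k⌋₊ + 1)
  start_i := R.start_i
  start_j := R.start_j
  stop_i := R.stop_i
  stop_j := R.stop_j
  step := R.step
  r_mem := by
    intro k h1 h2
    exact ⟨by omega, min_le_left _ _⟩
  r_mono := by
    intro k h1 h2 h
    have := R.t_mono k h1 h2 h
    apply min_le_min le_rfl
    apply Nat.succ_le_succ
    apply Nat.floor_le_floor
    exact mul_le_mul_of_nonneg_left this (Nat.cast_nonneg m)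

lemma RealPath.toRefined_pt {N : ℕ} (hN : 1 ≤ N) (R : RealPath N) {m : ℕ} (hm : 1 ≤ m) {k : ℕ}
    (hk : k ≤ 2 * N - 1) :
    |(R.pt k).1 - ((R.toRefined hm).toReal.pt k).1| ≤ 1 / m ∧
    |(R.pt k).2 - ((R.toRefined hm).toReal.pt k).2| ≤ 1 / m := by
  set R' := (R.toRefined hm).toReal with hR'
  have p : (0 : ℝ) ≤ 1 / m := by positivity
  rcases Nat.eq_zero_or_pos k with h | h
  · subst h
    rw [R.pt_zero, R'.pt_zero]; simp
  rcases hk.eq_or_lt with h' | h'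
  · subst h'
    rw [R.pt_top hN, R'.pt_top hN]; simp
  have ht := R.t_mem k h (by omega)
  have hd := disc hm ht.1 ht.2
  have key : ∀ c : ℝ, |(c + R.t k) / N - (c + R'.t k) / N| ≤ 1 / m := by
    intro c
    rw [← sub_div, add_sub_add_left_eq_sub, abs_div, Nat.abs_cast, abs_sub_comm]
    refine (div_le_self (abs_nonneg _) (by exact_mod_cast hN)).trans hd
  rcases R.center_cases h (by omega) with ⟨a, b, e⟩ | ⟨a, b, e⟩ <;>
  rcases R'.center_cases h (by omega) with ⟨a', b', e'⟩ | ⟨a', b', e'⟩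
  · rw [e, e']
    refine ⟨?_, key _⟩
    have : R'.i k = R.i k := rfl
    simp only [this, sub_self, abs_zero]; exact p
  · exfalso
    change R.i (k+1) = R.i k at a'
    omega
  · exfalso
    change R.i (k+1) = R.i k + 1 at a'
    omega
  · rw [e, e']
    refine ⟨key _, ?_⟩
    have : R'.j k = R.j k := rfl
    simp only [this, sub_self, abs_zero]; exact p

lemma RealPath.approx {u : ℝ × ℝ → ℝ} (hu : Continuous u) {M : ℝ} (hM : ∀ z, |u z| ≤ M)
    {N : ℕ} (hN : 1 ≤ N) (R : RealPath N) {m : ℕ} (hm : 1 ≤ m) :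
    R.sum u ≤ pathSum u N m (R.toRefined hm) +
      2 * ((2 * N - 1 : ℕ) * Real.sqrt (4 * M * (1 / m))) := by
  rw [pathSum_eq]
  set R' := (R.toRefined hm).toReal with hR'
  unfold RealPath.sum cs
  have : ∀ k ∈ Finset.range (2 * N - 1), Real.sqrt (bx u (R.ch k) (R.ch (k+1))) ≤
      Real.sqrt (bx u (R'.ch k) (R'.ch (k+1))) + Real.sqrt (4 * M * (1 / m)) := by
    intro k hk
    have hk := Finset.mem_range.1 hk
    refine (sqrt_diff (a := bx u (R'.ch k) (R'.ch (k+1)))).trans ?_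
    have g := R.good hN
    have g' := R'.good hN
    have h5 := g.dy1 k
    have h6 := g'.dx1 k
    have d1 := R.toRefined_pt hN hm (k := k) (by omega)
    have d2 := R.toRefined_pt hN hm (k := k + 1) (by omega)
    rw [← hR', ← R.ch_eq (by omega), ← R'.ch_eq (by omega)] at d1 d2
    have := Real.sqrt_le_sqrt (bx_diff hu hM d1.1 d1.2 d2.1 d2.2 h5 h6)
    rw [abs_sub_comm]
    linarith
  have := Finset.sum_le_sum this
  rw [Finset.sum_add_distrib, Finset.sum_const, Finset.card_range, nsmul_eq_mul] at this
  linarith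

section crossing
variable {Υ : Set (ℝ × ℝ)}

lemma up_total (h : Υ ∈ Bup 0 1 0 1) {p q : ℝ × ℝ} (hp : p ∈ Υ) (hq : q ∈ Υ) : p ≤ q ∨ q ≤ p := by
  have := h.2.2.2.2 p hp q hq
  rcases lt_trichotomy p.1 q.1 with a | a | a
  · left
    refine ⟨a.le, ?_⟩
    by_contra hc
    push Not at hc
    nlinarith
  · rcases le_total p.2 q.2 with b | b
    · exact Or.inl ⟨a.le, b⟩
    · exact Or.inr ⟨a.ge, b⟩
  · right
    refine ⟨a.le, ?_⟩
    by_contra hc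
    push Not at hc
    nlinarith

lemma exists_fst (h : Υ ∈ Bup 0 1 0 1) {c : ℝ} (hc : c ∈ Icc (0 : ℝ) 1) : ∃ p ∈ Υ, p.1 = c :=
  h.2.1.isPreconnected.intermediate_value h.2.2.1 h.2.2.2.1 continuous_fst.continuousOn hc

lemma exists_snd (h : Υ ∈ Bup 0 1 0 1) {c : ℝ} (hc : c ∈ Icc (0 : ℝ) 1) : ∃ p ∈ Υ, p.2 = c :=
  h.2.1.isPreconnected.intermediate_value h.2.2.1 h.2.2.2.1 continuous_snd.continuousOn hc

lemma exists_marks (h : Υ ∈ Bup 0 1 0 1) (f : ℝ × ℝ → ℝ) (hf0 : f (0, 0) = 0) (hf1 : f (1, 1) = 1)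
    (hfm : ∀ p q, p ≤ q → f p ≤ f q)
    (hf : ∀ c ∈ Icc (0 : ℝ) 1, ∃ p ∈ Υ, f p = c) {N : ℕ} (hN : 1 ≤ N) :
    ∃ A : ℕ → ℝ × ℝ, Monotone A ∧ A 0 = (0, 0) ∧ (∀ k, N ≤ k → A k = (1, 1)) ∧ (∀ k, A k ∈ Υ) ∧
      ∀ k ≤ N, f (A k) = (k : ℝ) / N := by
  classical
  have hN0 : (0 : ℝ) < N := by positivity
  choose! s hs1 hs2 using hf
  let A : ℕ → ℝ × ℝ := fun k => if k = 0 then (0, 0) else if N ≤ k then (1, 1) else s ((k : ℝ) / N)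
  have hc : ∀ k, k ≤ N → (k : ℝ) / N ∈ Icc (0 : ℝ) 1 := by
    intro k hk
    refine ⟨by positivity, ?_⟩
    rw [div_le_one hN0]
    exact_mod_cast hk
  have h0 : A 0 = (0, 0) := by simp [A]
  have ht : ∀ k, N ≤ k → A k = (1, 1) := by
    intro k hk
    simp only [A]
    rw [if_neg (by omega), if_pos hk]
  have hU : ∀ k, A k ∈ Υ := by
    intro k
    simp only [A]
    split_ifs with a b
    · exact h.2.2.1
    · exact h.2.2.2.1
    · exact hs1 _ (hc k (by omega))
  have hv : ∀ k ≤ N, f (A k) = (k : ℝ) / N := by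
    intro k hk
    simp only [A]
    split_ifs with a b
    · rw [a, hf0]; simp
    · have : k = N := le_antisymm hk b
      rw [hf1, this, div_self hN0.ne']
    · exact hs2 _ (hc k (by omega))
  refine ⟨A, monotone_nat_of_le_succ ?_, h0, ht, hU, hv⟩
  intro k
  rcases lt_or_ge k N with hk | hk
  · rcases up_total h (hU k) (hU (k + 1)) with g | g
    · exact g
    · exfalso
      have := hfm _ _ g
      rw [hv _ hk.le, hv _ hk, div_le_div_iff_of_pos_right hN0] at this
      push_cast at this
      linarith
  · rw [ht k hk, ht (k + 1) (by omega)]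

open Classical in
/-- merging state -/
noncomputable def mst (A B : ℕ → ℝ × ℝ) : ℕ → ℕ × ℕ
  | 0 => (0, 0)
  | k + 1 => if A ((mst A B k).1 + 1) ≤ B ((mst A B k).2 + 1) then
      ((mst A B k).1 + 1, (mst A B k).2) else ((mst A B k).1, (mst A B k).2 + 1)

lemma mst_succ (A B : ℕ → ℝ × ℝ) (k : ℕ) :
    (A ((mst A B k).1 + 1) ≤ B ((mst A B k).2 + 1) ∧
      (mst A B (k+1)).1 = (mst A B k).1 + 1 ∧ (mst A B (k+1)).2 = (mst A B k).2) ∨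
    (¬ A ((mst A B k).1 + 1) ≤ B ((mst A B k).2 + 1) ∧
      (mst A B (k+1)).1 = (mst A B k).1 ∧ (mst A B (k+1)).2 = (mst A B k).2 + 1) := by
  by_cases h : A ((mst A B k).1 + 1) ≤ B ((mst A B k).2 + 1)
  · left
    refine ⟨h, ?_⟩
    rw [mst, if_pos h]
    exact ⟨rfl, rfl⟩
  · right
    refine ⟨h, ?_⟩
    rw [mst, if_neg h]
    exact ⟨rfl, rfl⟩

open Classical in
noncomputable def mpos (A B : ℕ → ℝ × ℝ) (N : ℕ) (k : ℕ) : ℝ :=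
  if A ((mst A B k).1 + 1) ≤ B ((mst A B k).2 + 1) then
    N * (A ((mst A B k).1 + 1)).2 - (mst A B k).2
  else N * (B ((mst A B k).2 + 1)).1 - (mst A B k).1

lemma crossing (h : Υ ∈ Bup 0 1 0 1) {N : ℕ} (hN : 1 ≤ N) :
    ∃ R : RealPath N, ∀ k ≤ 2 * N - 1, R.pt k ∈ Υ := by
  have hN0 : (0 : ℝ) < N := by positivity
  obtain ⟨A, Am, A0, At, AU, Av⟩ := exists_marks h Prod.fst rfl rfl (fun p q hpq => hpq.1)
    (fun c hc => exists_fst h hc) hN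
  obtain ⟨B, Bm, B0, Bt, BU, Bv⟩ := exists_marks h Prod.snd rfl rfl (fun p q hpq => hpq.2)
    (fun c hc => exists_snd h hc) hN
  set S := mst A B with hS
  have hS0 : S 0 = (0, 0) := rfl
  have inv : ∀ k, k ≤ 2 * N - 2 → (S k).1 + (S k).2 = k ∧ (S k).1 < N ∧ (S k).2 < N ∧
      A (S k).1 ≤ B ((S k).2 + 1) ∧ B (S k).2 ≤ A ((S k).1 + 1) := by
    intro k
    induction k with
    | zero =>
      intro _
      rw [hS0]
      refine ⟨rfl, hN, hN, ?_, ?_⟩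
      · rw [A0, ← B0]; exact Bm (Nat.zero_le _)
      · rw [B0, ← A0]; exact Am (Nat.zero_le _)
    | succ k ih =>
      intro hk
      obtain ⟨i1, i2, i3, i4, i5⟩ := ih (by omega)
      rcases mst_succ A B k with ⟨c, e1, e2⟩ | ⟨c, e1, e2⟩ <;> rw [← hS] at c e1 e2 <;> rw [e1, e2]
      · refine ⟨by omega, ?_, i3, c, i5.trans (Am (Nat.le_succ _))⟩
        by_contra hc
        have hc' : N ≤ (S k).1 + 1 := by omega
        rw [At _ hc'] at c
        have := c.2
        rw [Bv _ (by omega), le_div_iff₀ hN0] at this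
        have h2 : (((S k).2 + 1 : ℕ) : ℝ) < N := by exact_mod_cast (by omega : (S k).2 + 1 < N)
        linarith
      · have c' := (up_total h (AU ((S k).1 + 1)) (BU ((S k).2 + 1))).resolve_left c
        refine ⟨by omega, i2, ?_, i4.trans (Bm (Nat.le_succ _)), c'⟩
        by_contra hc
        have hc' : N ≤ (S k).2 + 1 := by omega
        apply c
        rw [Bt _ hc']
        exact (h.1 (AU _)).2
  -- bounds on marks
  have bd : ∀ k, k ≤ 2 * N - 2 → 
      (A ((S k).1 + 1)).1 = (((S k).1 : ℝ) + 1) / N ∧ (B ((S k).2 + 1)).2 = (((S k).2 : ℝ) + 1) / N ∧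
      ((S k).2 : ℝ) / N ≤ (A ((S k).1 + 1)).2 ∧ ((S k).1 : ℝ) / N ≤ (B ((S k).2 + 1)).1 := by
    intro k hk
    obtain ⟨i1, i2, i3, i4, i5⟩ := inv k hk
    have a := Av ((S k).1 + 1) i2
    have b := Bv ((S k).2 + 1) i3
    push_cast at a b
    refine ⟨a, b, ?_, ?_⟩
    · rw [← Bv _ i3.le]; exact i5.2
    · rw [← Av _ i2.le]; exact i4.1
  have mem : ∀ k, k ≤ 2 * N - 2 → 0 ≤ mpos A B N k ∧ mpos A B N k ≤ 1 := by
    intro k hk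
    obtain ⟨b1, b2, b3, b4⟩ := bd k hk
    unfold mpos
    rw [← hS]
    rw [div_le_iff₀ hN0] at b3 b4
    split_ifs with c
    · have := c.2
      rw [b2, le_div_iff₀ hN0] at this
      constructor <;> linarith
    · have c' := (up_total h (AU ((S k).1 + 1)) (BU ((S k).2 + 1))).resolve_left c
      have := c'.1
      rw [b1, le_div_iff₀ hN0] at this
      constructor <;> linarith
  refine ⟨{ i := fun k => (S (k - 1)).1 + 1
            j := fun k => (S (k - 1)).2 + 1
            t := fun k => mpos A B N (k - 1)
            start_i := by simp [hS0]
            start_j := by simp [hS0]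
            stop_i := ?_
            stop_j := ?_
            step := ?_
            t_mem := ?_
            t_mono := ?_ }, ?_⟩
  · have := inv (2 * N - 1 - 1) (by omega)
    omega
  · have := inv (2 * N - 1 - 1) (by omega)
    omega
  · intro k h1 h2
    obtain ⟨k, rfl⟩ : ∃ l, k = l + 1 := ⟨k - 1, by omega⟩
    simp only [Nat.add_sub_cancel]
    rcases mst_succ A B k with ⟨c, e1, e2⟩ | ⟨c, e1, e2⟩ <;> rw [← hS] at c e1 e2 <;> rw [e1, e2]
    · left; exact ⟨rfl, rfl⟩
    · right; exact ⟨rfl, rfl⟩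
  · intro k h1 h2
    exact mem _ (by omega)
  · intro k h1 h2
    obtain ⟨k, rfl⟩ : ∃ l, k = l + 1 := ⟨k - 1, by omega⟩
    have e : k + 1 + 2 - 1 = k + 1 + 1 := by omega
    simp only [Nat.add_sub_cancel, e]
    intro hh
    unfold mpos
    rw [← hS]
    rcases mst_succ A B k with ⟨c, e1, e2⟩ | ⟨c, e1, e2⟩ <;>
    rcases mst_succ A B (k + 1) with ⟨c', e1', e2'⟩ | ⟨c', e1', e2'⟩ <;>
    rw [← hS] at c e1 e2 c' e1' e2'
    · rw [if_pos c, if_pos c', e1, e2]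
      have := mul_le_mul_of_nonneg_left (Am (Nat.le_succ ((S k).1 + 1))).2 hN0.le
      linarith
    · omega
    · omega
    · rw [if_neg c, if_neg c', e1, e2]
      have := mul_le_mul_of_nonneg_left (Bm (Nat.le_succ ((S k).2 + 1))).1 hN0.le
      linarith
  · intro k hk
    unfold RealPath.pt
    split_ifs with g1 g2
    · exact h.2.2.1
    · exact h.2.2.2.1
    obtain ⟨k, rfl⟩ : ∃ l, k = l + 1 := ⟨k - 1, by omega⟩
    obtain ⟨b1, b2, b3, b4⟩ := bd k (by omega)
    unfold RealPath.center
    simp only [Nat.add_sub_cancel]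
    rcases mst_succ A B k with ⟨c, e1, e2⟩ | ⟨c, e1, e2⟩ <;> rw [← hS] at c e1 e2
    · rw [if_pos (by omega)]
      unfold mpos
      rw [← hS, if_pos c]
      convert AU ((S k).1 + 1) using 1
      ext
      · simp [b1]
      · simp only; push_cast; field_simp; ring
    · rw [if_neg (by omega)]
      unfold mpos
      rw [← hS, if_neg c]
      convert BU ((S k).2 + 1) using 1
      ext
      · simp only; push_cast; field_simp; ring
      · simp [b2]

end crossing

lemma diag_mem : (fun x : ℝ => (x, x)) '' Icc (0 : ℝ) 1 ∈ Bup 0 1 0 1 := by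
  refine ⟨?_, ?_, ?_, ?_, ?_⟩
  · rintro _ ⟨x, hx, rfl⟩
    exact ⟨⟨hx.1, hx.1⟩, ⟨hx.2, hx.2⟩⟩
  · exact (isConnected_Icc zero_le_one).image _ (by fun_prop)
  · exact ⟨0, ⟨le_rfl, zero_le_one⟩, rfl⟩
  · exact ⟨1, ⟨zero_le_one, le_rfl⟩, rfl⟩
  · rintro _ ⟨s, hs, rfl⟩ _ ⟨t, ht, rfl⟩
    exact mul_self_nonneg _

lemma crossing_chain {Υ : Set (ℝ × ℝ)} (h : Υ ∈ Bup 0 1 0 1) {N : ℕ} (hN : 1 ≤ N) :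
    ∃ R : RealPath N, IsChain' Υ (2 * N - 1) R.ch := by
  obtain ⟨R, hR⟩ := crossing h hN
  exact ⟨R, (R.good hN).mono, (R.good hN).zero, (R.good hN).top _ le_rfl,
    fun k => hR _ (min_le_right _ _)⟩

/-- the theorem for globally continuous bounded densities -/
lemma main_aux (u : ℝ × ℝ → ℝ) (hu : Continuous u) (hu0 : ∀ z, 0 ≤ u z) {M : ℝ}
    (hM : ∀ z, |u z| ≤ M)
    (hmod : ∀ ω > 0, ∃ δ > 0, ∀ p ∈ Icc ((0:ℝ),(0:ℝ)) (1,1), ∀ q ∈ Icc ((0:ℝ),(0:ℝ)) (1,1),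
      |p.1 - q.1| < δ → |p.2 - q.2| < δ → |u p - u q| ≤ ω) :
    ∃ g : ℕ → ℝ,
      (∀ N : ℕ, Tendsto (fun m : ℕ => ⨆ Γ : RefinedPath N m, pathSum u N m Γ)
        atTop (nhds (g N))) ∧
      Tendsto g atTop
        (nhds (⨆ Υ : ↥(Bup 0 1 0 1), Jcurve 0 1 0 1 u ↑Υ)) := by
  have bddR : ∀ N : ℕ, 1 ≤ N → BddAbove (range fun R : RealPath N => R.sum u) := by
    intro N hN
    refine ⟨2 * Real.sqrt M, ?_⟩
    rintro _ ⟨R, rfl⟩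
    exact R.sum_le hu hM hN
  have neR : ∀ N : ℕ, 1 ≤ N → Nonempty (RealPath N) := fun N hN =>
    ⟨(crossing diag_mem hN).choose⟩
  have bddJ : BddAbove (range fun Υ : ↥(Bup 0 1 0 1) => Jcurve 0 1 0 1 u ↑Υ) := by
    refine ⟨2 * Real.sqrt M, ?_⟩
    rintro _ ⟨R, rfl⟩
    exact Jcurve_bdd hu hM _
  have neU : Nonempty ↥(Bup 0 1 0 1) := ⟨⟨_, diag_mem⟩⟩
  refine ⟨fun N => ⨆ R : RealPath N, R.sum u, ?_, ?_⟩
  · intro N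
    rcases Nat.eq_zero_or_pos N with h0 | hN
    · subst h0
      have e1 : (⨆ R : RealPath 0, R.sum u) = 0 := by
        have : ∀ R : RealPath 0, R.sum u = 0 := fun R => by simp [RealPath.sum, cs]
        simp only [this, Real.iSup_const_zero]
      have e2 : (fun m : ℕ => ⨆ Γ : RefinedPath 0 m, pathSum u 0 m Γ) = fun _ => 0 := by
        ext m
        have : ∀ Γ : RefinedPath 0 m, pathSum u 0 m Γ = 0 := fun Γ => by simp [pathSum]
        simp only [this, Real.iSup_const_zero]
      rw [e2]
      change Tendsto _ _ (nhds (⨆ R : RealPath 0, R.sum u))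
      rw [e1]
      exact tendsto_const_nhds
    · have := neR N hN
      have hb : ∀ m, BddAbove (range fun Γ : RefinedPath N m => pathSum u N m Γ) := by
        intro m
        refine ⟨2 * Real.sqrt M, ?_⟩
        rintro _ ⟨Γ, rfl⟩
        simp only [pathSum_eq]
        exact Γ.toReal.sum_le hu hM hN
      have lim : Tendsto (fun m : ℕ => (⨆ R : RealPath N, R.sum u) -
          2 * ((2 * N - 1 : ℕ) * Real.sqrt (4 * M * (1 / m)))) atTop
          (nhds (⨆ R : RealPath N, R.sum u)) := by
        have h1 : Tendsto (fun m : ℕ => (1 : ℝ) / m) atTop (nhds 0) := tendsto_one_div_atTop_nhds_zero_nat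
        have h2 := ((Real.continuous_sqrt.tendsto _).comp (h1.const_mul (4 * M)))
        have h3 := ((h2.const_mul ((2 * N - 1 : ℕ) : ℝ)).const_mul 2).const_sub
          (⨆ R : RealPath N, R.sum u)
        simpa using h3
      refine tendsto_of_tendsto_of_tendsto_of_le_of_le' lim tendsto_const_nhds ?_ ?_
      · filter_upwards [eventually_ge_atTop 1] with m hm
        rw [sub_le_iff_le_add]
        apply ciSup_le
        intro R
        refine (R.approx hu hM hN hm).trans ?_
        have := le_ciSup (hb m) (R.toRefined hm)
        linarith
      · filter_upwards [eventually_ge_atTop 1] with m hm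
        have : Nonempty (RefinedPath N m) := this.map (fun R => R.toRefined hm)
        apply ciSup_le
        intro Γ
        rw [pathSum_eq]
        exact le_ciSup (bddR N hN) Γ.toReal
  · rw [Metric.tendsto_atTop]
    intro e he
    -- lower
    obtain ⟨⟨Υ, hΥ⟩, hJ⟩ := exists_lt_of_lt_ciSup
      (show (⨆ Υ : ↥(Bup 0 1 0 1), Jcurve 0 1 0 1 u ↑Υ) - e < ⨆ Υ : ↥(Bup 0 1 0 1), Jcurve 0 1 0 1 u ↑Υ by linarith)
    obtain ⟨ε, hε, hJ⟩ := Jcurve_lt hJ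
    -- upper
    have hω : 0 < e ^ 2 / 48 := by positivity
    obtain ⟨δ, hδ, hmod⟩ := hmod _ hω
    have hsq : 2 * Real.sqrt (3 * (e ^ 2 / 48)) = e / 2 := by
      rw [show 3 * (e ^ 2 / 48) = (e / 4) ^ 2 by ring, Real.sqrt_sq (by positivity)]
      ring
    obtain ⟨N0, hN0⟩ := exists_nat_gt (max (1 / ε) (1 / δ))
    refine ⟨max N0 1, fun N hN => ?_⟩
    have hN1 : 1 ≤ N := (le_max_right _ _).trans hN
    have hNpos : (0 : ℝ) < N := by positivity
    have hNN : (N0 : ℝ) ≤ N := by exact_mod_cast (le_max_left _ _).trans hN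
    have n1 : (1 : ℝ) / N < ε := by
      rw [one_div_lt hNpos hε]; linarith [le_max_left (1 / ε) (1 / δ)]
    have n2 : (1 : ℝ) / N < δ := by
      rw [one_div_lt hNpos hδ]; linarith [le_max_right (1 / ε) (1 / δ)]
    have := neR N hN1
    rw [Real.dist_eq, abs_lt]
    constructor
    · obtain ⟨R, hR⟩ := crossing_chain hΥ hN1
      have a := hJ _ _ hR (fun k _ => ⟨(R.ch_mesh hN1 k).1.trans_lt n1, (R.ch_mesh hN1 k).2.trans_lt n1⟩)
      have b := le_ciSup (bddR N hN1) R
      have c : R.sum u = cs u (2 * N - 1) R.ch := rfl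
      linarith
    · have : (⨆ R : RealPath N, R.sum u) ≤
          (⨆ Υ : ↥(Bup 0 1 0 1), Jcurve 0 1 0 1 u ↑Υ) + e / 2 := by
        apply ciSup_le
        intro R
        have g := R.good hN1
        have hmesh : ∀ k, (R.ch (k+1)).1 - (R.ch k).1 < δ ∧ (R.ch (k+1)).2 - (R.ch k).2 < δ :=
          fun k => ⟨(R.ch_mesh hN1 k).1.trans_lt n2, (R.ch_mesh hN1 k).2.trans_lt n2⟩
        have a : R.sum u - e / 2 ≤ Jcurve 0 1 0 1 u (poly R.ch (2 * N - 1)) := by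
          refine le_Jcurve hu hM _ hδ ?_ ?_
          · obtain ⟨R', hR'⟩ := crossing_chain g.poly_mem hN1
            exact ⟨_, _, hR', fun k _ =>
              ⟨(R'.ch_mesh hN1 k).1.trans_lt n2, (R'.ch_mesh hN1 k).2.trans_lt n2⟩⟩
          · intro n Q hQ hQm
            rw [← hsq]
            exact g.compare hu hu0 hM hω hmod hmesh hQ hQm
        have b := le_ciSup bddJ ⟨_, g.poly_mem⟩
        simp only at b
        linarith
      linarith

/-- The maximal `J̃(u,Υ)` over `Υ ∈ B↗([0,1]²)` equals the iterated limit (first `m → ∞`,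
then `N → ∞`) of the maximal path sums over refined paths `Γ ∈ Π_{N,m}`. -/
theorem max_Jcurve_eq_lim_path_sums (u : ℝ × ℝ → ℝ)
    (hu : ContinuousOn u (Set.Icc ((0 : ℝ), (0 : ℝ)) (1, 1)))
    (hu0 : ∀ p ∈ Set.Icc ((0 : ℝ), (0 : ℝ)) (1, 1), 0 ≤ u p)
    (hdens : ∫ p in Set.Icc ((0 : ℝ), (0 : ℝ)) (1, 1), u p = 1) :
    ∃ g : ℕ → ℝ,
      (∀ N : ℕ, Tendsto (fun m : ℕ => ⨆ Γ : RefinedPath N m, pathSum u N m Γ)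
        atTop (nhds (g N))) ∧
      Tendsto g atTop
        (nhds (⨆ Υ : ↥(Bup 0 1 0 1), Jcurve 0 1 0 1 u ↑Υ)) := by
  have hcpt : IsCompact (Icc ((0 : ℝ), (0 : ℝ)) (1, 1)) := isCompact_Icc
  let c : ℝ × ℝ → ℝ × ℝ := fun p => (max 0 (min 1 p.1), max 0 (min 1 p.2))
  have hc : Continuous c := by fun_prop
  have hcm : ∀ p, c p ∈ Icc ((0 : ℝ), (0 : ℝ)) (1, 1) := fun p =>
    ⟨⟨le_max_left _ _, le_max_left _ _⟩,
      ⟨max_le zero_le_one (min_le_left _ _), max_le zero_le_one (min_le_left _ _)⟩⟩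
  have hce : ∀ p ∈ Icc ((0 : ℝ), (0 : ℝ)) (1, 1), c p = p := by
    intro p hp
    have h1 := hp.1.1
    have h2 := hp.1.2
    have h3 := hp.2.1
    have h4 := hp.2.2
    simp only at h1 h2 h3 h4
    simp only [c]
    rw [min_eq_right h3, min_eq_right h4, max_eq_right h1, max_eq_right h2]
  set v : ℝ × ℝ → ℝ := fun p => u (c p) with hv
  have hvc : Continuous v := hu.comp_continuous hc hcm
  have hvu : ∀ p ∈ Icc ((0 : ℝ), (0 : ℝ)) (1, 1), v p = u p := fun p hp => by
    simp only [hv, hce p hp]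
  obtain ⟨M, hM⟩ := hcpt.exists_bound_of_continuousOn hu
  have hmod : ∀ ω > 0, ∃ δ > 0, ∀ p ∈ Icc ((0:ℝ),(0:ℝ)) (1,1), ∀ q ∈ Icc ((0:ℝ),(0:ℝ)) (1,1),
      |p.1 - q.1| < δ → |p.2 - q.2| < δ → |v p - v q| ≤ ω := by
    intro ω hω
    have := hcpt.uniformContinuousOn_of_continuous hvc.continuousOn
    rw [Metric.uniformContinuousOn_iff] at this
    obtain ⟨δ, hδ, h⟩ := this ω hω
    refine ⟨δ, hδ, fun p hp q hq h1 h2 => (h p hp q hq ?_).le⟩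
    rw [Prod.dist_eq]
    exact max_lt h1 h2
  have key := main_aux v hvc (fun z => hu0 _ (hcm z)) (M := M) (fun z => hM _ (hcm z)) hmod
  have bxe : ∀ p ∈ Icc ((0:ℝ),(0:ℝ)) (1,1), ∀ q ∈ Icc ((0:ℝ),(0:ℝ)) (1,1),
      bx v p q = bx u p q := by
    intro p hp q hq
    unfold bx
    apply intervalIntegral.integral_congr
    intro s hs
    apply intervalIntegral.integral_congr
    intro t ht
    apply hvu
    have hs' : s ∈ Icc (0 : ℝ) 1 := uIcc_subset_Icc ⟨hp.1.1, hp.2.1⟩ ⟨hq.1.1, hq.2.1⟩ hs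
    have ht' : t ∈ Icc (0 : ℝ) 1 := uIcc_subset_Icc ⟨hp.1.2, hp.2.2⟩ ⟨hq.1.2, hq.2.2⟩ ht
    exact ⟨⟨hs'.1, ht'.1⟩, ⟨hs'.2, ht'.2⟩⟩
  have cse : ∀ n (P : ℕ → ℝ × ℝ), (∀ k, P k ∈ Icc ((0:ℝ),(0:ℝ)) (1,1)) → cs v n P = cs u n P := by
    intro n P hP
    unfold cs
    congr 1
    exact Finset.sum_congr rfl (fun k _ => by rw [bxe _ (hP _) _ (hP _)])
  have hp : ∀ N m (Γ : RefinedPath N m), pathSum v N m Γ = pathSum u N m Γ := by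
    intro N m Γ
    rcases Nat.eq_zero_or_pos N with h0 | hN
    · subst h0; simp [pathSum]
    · rw [pathSum_eq, pathSum_eq]
      exact cse _ _ (fun k => (Γ.toReal.good hN).mem k)
  have hJ : ∀ Υ : ↥(Bup 0 1 0 1), Jcurve 0 1 0 1 v ↑Υ = Jcurve 0 1 0 1 u ↑Υ := by
    rintro ⟨Υ, hΥ⟩
    unfold Jcurve
    congr 1
    ext ε
    congr 1
    ext r
    refine exists_congr fun n => exists_congr fun x => exists_congr fun y => ?_
    refine and_congr_right fun h1 => and_congr_right fun _ => ?_
    obtain ⟨Q, hQ, e⟩ := partition_to_chain h1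
    rw [Jpart_eq_cs v n x y Q e, Jpart_eq_cs u n x y Q e, cse _ _ (fun k => hΥ.1 (hQ.2.2.2 k))]
  simp only [hp, hJ] at key
  exact key
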